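/- Let D ≥ 1 be an integer. Let q : [0,1) → ℝ_+^D be bounded, right-continuous and strictly increasing (meaning q(s') − q(s) ∈ (0,∞)^D whenever 0 ≤ s < s' < 1), and let μ be the law of q(U) with U uniform on [0,1). For each n ∈ ℕ, let ϖ_n be a probability measure on ℝ_+^D × ℝ_+^D and suppose there exists an ℝ_+^D-increasing measurable map T_n : ℝ_+^D → ℝ_+^D such that x' = T_n(x) for ϖ_n-almost every pair (x, x'). Assume that ϖ_n converges weakly to a probability measure ϖ on ℝ_+^D × ℝ_+^D whose projection onto the first D coordinates equals μ. Then ϖ is a monotone probability measure on ℝ_+^{2D}. -/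

import Mathlib

open MeasureTheory

/-- The nonnegative orthant `ℝ_+^D` in `ℝ^D`. -/
def orthant (D : ℕ) : Set (EuclideanSpace ℝ (Fin D)) := {x | ∀ i, 0 ≤ x i}

lemma exists_of_support {X : Type*} [TopologicalSpace X] [MeasurableSpace X] [BorelSpace X]
    [HasOuterApproxClosed X]
    (ϖn : ℕ → Measure X) (hprobn : ∀ n, IsProbabilityMeasure (ϖn n))
    (ϖ : Measure X) (hϖprob : IsProbabilityMeasure ϖ)
    (hweak : ∀ f : BoundedContinuousFunction X ℝ,
      Filter.Tendsto (fun n => ∫ p, f p ∂(ϖn n)) Filter.atTop (nhds (∫ p, f p ∂ϖ)))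
    (U : Set X) (hU : IsOpen U) (h : 0 < ϖ U) : ∀ᶠ n in Filter.atTop, 0 < ϖn n U := by
  let P : ℕ → ProbabilityMeasure X := fun n => ⟨ϖn n, hprobn n⟩
  let Q : ProbabilityMeasure X := ⟨ϖ, hϖprob⟩
  have ht : Filter.Tendsto P Filter.atTop (nhds Q) := by
    rw [ProbabilityMeasure.tendsto_iff_forall_integral_tendsto]
    exact hweak
  have := ProbabilityMeasure.le_liminf_measure_open_of_tendsto ht hU
  exact Filter.eventually_lt_of_lt_liminf (lt_of_lt_of_le h this)

/-- let `q : [0,1) → ℝ_+^D` be bounded, right-continuous and strictly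
increasing, and let `μ` be the law of `q(U)` with `U` uniform on `[0,1)`.  If `ϖ_n` are
probability measures on `ℝ_+^D × ℝ_+^D` such that `x' = T_n(x)` for `ϖ_n`-a.e. `(x,x')`,
where `T_n` is an `ℝ_+^D`-increasing measurable map, and `ϖ_n` converges weakly to a
probability measure `ϖ` whose first projection is `μ`, then `ϖ` is a monotone probability
measure on `ℝ_+^{2D}`. -/
theorem limit_monotone (D : ℕ) (hD : 1 ≤ D)
    (q : ℝ → EuclideanSpace ℝ (Fin D))
    (hqmeas : AEMeasurable q (volume.restrict (Set.Ico (0 : ℝ) 1)))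
    (hqbdd : ∃ Cq : ℝ, ∀ s : ℝ, 0 ≤ s → s < 1 → ‖q s‖ ≤ Cq)
    (hqcone : ∀ s : ℝ, 0 ≤ s → s < 1 → q s ∈ orthant D)
    (hqrc : ∀ s : ℝ, 0 ≤ s → s < 1 → ContinuousWithinAt q (Set.Ici s) s)
    (hqsi : ∀ s s' : ℝ, 0 ≤ s → s < s' → s' < 1 → ∀ i, q s i < q s' i)
    (ϖn : ℕ → Measure (EuclideanSpace ℝ (Fin D) × EuclideanSpace ℝ (Fin D)))
    (hprobn : ∀ n, IsProbabilityMeasure (ϖn n))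
    (hconen : ∀ n, ϖn n {p : EuclideanSpace ℝ (Fin D) × EuclideanSpace ℝ (Fin D) |
      p.1 ∈ orthant D ∧ p.2 ∈ orthant D}ᶜ = 0)
    (T : ℕ → EuclideanSpace ℝ (Fin D) → EuclideanSpace ℝ (Fin D))
    (hTmeas : ∀ n, Measurable (T n))
    (hTcone : ∀ n, ∀ x ∈ orthant D, T n x ∈ orthant D)
    (hTmono : ∀ n, ∀ x ∈ orthant D, ∀ y ∈ orthant D, ∀ i, T n x i ≤ T n (x + y) i)
    (hTae : ∀ n, ϖn n {p : EuclideanSpace ℝ (Fin D) × EuclideanSpace ℝ (Fin D) |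
      p.2 = T n p.1}ᶜ = 0)
    (ϖ : Measure (EuclideanSpace ℝ (Fin D) × EuclideanSpace ℝ (Fin D)))
    (hϖprob : IsProbabilityMeasure ϖ)
    (hweak : ∀ f : BoundedContinuousFunction
        (EuclideanSpace ℝ (Fin D) × EuclideanSpace ℝ (Fin D)) ℝ,
      Filter.Tendsto (fun n => ∫ p, f p ∂(ϖn n)) Filter.atTop (nhds (∫ p, f p ∂ϖ)))
    (hmarg : ϖ.map Prod.fst = Measure.map q (volume.restrict (Set.Ico (0 : ℝ) 1))) :
    ∃ qp : ℝ → EuclideanSpace ℝ (Fin D) × EuclideanSpace ℝ (Fin D),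
      AEMeasurable qp (volume.restrict (Set.Ico (0 : ℝ) 1)) ∧
      (∀ s : ℝ, 0 ≤ s → s < 1 → (qp s).1 ∈ orthant D ∧ (qp s).2 ∈ orthant D) ∧
      (∀ s t : ℝ, 0 ≤ s → s ≤ t → t < 1 →
        (∀ i, (qp s).1 i ≤ (qp t).1 i) ∧ (∀ i, (qp s).2 i ≤ (qp t).2 i)) ∧
      ϖ = Measure.map qp (volume.restrict (Set.Ico (0 : ℝ) 1)) := by
  classical
  set lam := volume.restrict (Set.Ico (0 : ℝ) 1) with hlam
  have key := exists_of_support ϖn hprobn ϖ hϖprob hweak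
  have hgood : ∀ n, ∀ᵐ p ∂(ϖn n), (p.1 ∈ orthant D ∧ p.2 ∈ orthant D) ∧ p.2 = T n p.1 := by
    intro n
    have h1 : ∀ᵐ p ∂(ϖn n), (p.1 ∈ orthant D ∧ p.2 ∈ orthant D) := hconen n
    have h2 : ∀ᵐ p ∂(ϖn n), p.2 = T n p.1 := hTae n
    filter_upwards [h1, h2] with p a b using ⟨a, b⟩
  have hex : ∀ n U, 0 < ϖn n U → ∃ p ∈ U, (p.1 ∈ orthant D ∧ p.2 ∈ orthant D) ∧ p.2 = T n p.1 := by
    intro n U hU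
    by_contra! hcon
    have : ϖn n U = 0 := by
      refine measure_mono_null (fun p hp => ?_) (hgood n)
      intro h
      exact hcon p hp h.1 h.2
    exact hU.ne' this
  set S := ϖ.support with hS
  have hSU : ∀ p ∈ S, ∀ U, IsOpen U → p ∈ U → 0 < ϖ U := by
    intro p hp U hU hpU
    exact (Measure.mem_support_iff_forall p).1 hp U (hU.mem_nhds hpU)
  have hSae : ∀ᵐ p ∂ϖ, p ∈ S := Measure.support_mem_ae
  have hSmono : ∀ p ∈ S, ∀ r ∈ S, (∀ i, p.1 i < r.1 i) → ∀ i, p.2 i ≤ r.2 i := by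
    intro p hp r hr hlt i
    by_contra! hcon
    obtain ⟨c, hc1, hc2⟩ := exists_between hcon
    choose m hm1 hm2 using fun j => exists_between (hlt j)
    have hU : IsOpen {a : EuclideanSpace ℝ (Fin D) × EuclideanSpace ℝ (Fin D) |
        (∀ j, a.1 j < m j) ∧ c < a.2 i} := by
      simp only [Set.ofPred_and, Set.ofPred_forall]
      refine IsOpen.inter (isOpen_iInter_of_finite fun j => ?_) ?_
      · exact isOpen_lt (by fun_prop) (by fun_prop)
      · exact isOpen_lt (by fun_prop) (by fun_prop)
    have hW : IsOpen {a : EuclideanSpace ℝ (Fin D) × EuclideanSpace ℝ (Fin D) |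
        (∀ j, m j < a.1 j) ∧ a.2 i < c} := by
      simp only [Set.ofPred_and, Set.ofPred_forall]
      refine IsOpen.inter (isOpen_iInter_of_finite fun j => ?_) ?_
      · exact isOpen_lt (by fun_prop) (by fun_prop)
      · exact isOpen_lt (by fun_prop) (by fun_prop)
    have eU := key _ hU (hSU p hp _ hU ⟨hm1, hc2⟩)
    have eW := key _ hW (hSU r hr _ hW ⟨hm2, hc1⟩)
    obtain ⟨n, nU, nW⟩ := (eU.and eW).exists
    obtain ⟨a, ⟨a1, a2⟩, ⟨a3, -⟩, a4⟩ := hex n _ nU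
    obtain ⟨b, ⟨b1, b2⟩, -, b4⟩ := hex n _ nW
    have := hTmono n a.1 a3 (b.1 - a.1) (fun j => by
      have := a1 j
      have := b1 j
      simp only [PiLp.sub_apply]
      linarith) i
    rw [add_sub_cancel, ← a4, ← b4] at this
    linarith
  have hSnn : ∀ p ∈ S, ∀ i, 0 ≤ p.2 i := by
    intro p hp i
    by_contra! hcon
    have hU : IsOpen {a : EuclideanSpace ℝ (Fin D) × EuclideanSpace ℝ (Fin D) | a.2 i < 0} :=
      isOpen_lt (by fun_prop) (by fun_prop)
    obtain ⟨n, nU⟩ := (key _ hU (hSU p hp _ hU hcon)).exists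
    obtain ⟨a, a1, ⟨-, a3⟩, -⟩ := hex n _ nU
    exact absurd (a3 i) (not_le.2 a1)
  -- the inverse of q
  let i0 : Fin D := ⟨0, hD⟩
  let A : ℝ → Set ℝ := fun c => {s | 0 ≤ s ∧ s < 1 ∧ (s = 0 ∨ q s i0 ≤ c)}
  have hAbdd : ∀ c, BddAbove (A c) := fun c => ⟨1, fun s hs => hs.2.1.le⟩
  let τ0 : ℝ → ℝ := fun c => sSup (A c)
  have hτ0 : Monotone τ0 := by
    intro c d hcd
    refine csSup_le_csSup (hAbdd d) ⟨0, le_rfl, one_pos, Or.inl rfl⟩ ?_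
    rintro s ⟨h1, h2, h3⟩
    exact ⟨h1, h2, h3.imp id (fun h => h.trans hcd)⟩
  let τ : EuclideanSpace ℝ (Fin D) → ℝ := fun x => τ0 (x i0)
  have hτm : Measurable τ := hτ0.measurable.comp (by fun_prop)
  have hτq : ∀ s, 0 ≤ s → s < 1 → τ (q s) = s := by
    intro s h0 h1
    have : A (q s i0) = Set.Icc 0 s := by
      ext r
      constructor
      · rintro ⟨r0, r1, h⟩
        refine ⟨r0, ?_⟩
        by_contra! hc
        rcases h with h | h
        · linarith
        · exact absurd (hqsi s r h0 hc r1 i0) (not_lt.2 h)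
      · rintro ⟨r0, r1⟩
        refine ⟨r0, by linarith, Or.inr ?_⟩
        rcases r1.eq_or_lt with h | h
        · rw [h]
        · exact (hqsi r s r0 h h1 i0).le
    show sSup (A (q s i0)) = s
    rw [this, csSup_Icc h0]
  have hIco : ∀ᵐ s ∂lam, s ∈ Set.Ico (0 : ℝ) 1 := ae_restrict_mem measurableSet_Ico
  have hτq' : ∀ᵐ s ∂lam, τ (q s) = s := by
    filter_upwards [hIco] with s hs using hτq s hs.1 hs.2
  let V : EuclideanSpace ℝ (Fin D) × EuclideanSpace ℝ (Fin D) → ℝ := fun p => τ p.1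
  have hVm : Measurable V := hτm.comp measurable_fst
  have hμτ : (Measure.map q lam).map τ = lam := by
    rw [AEMeasurable.map_map_of_aemeasurable hτm.aemeasurable hqmeas]
    exact (Measure.map_congr (f := τ ∘ q) (g := id) hτq').trans Measure.map_id
  have hV : ϖ.map V = lam := by
    rw [← hμτ, ← hmarg, Measure.map_map hτm measurable_fst]
    rfl
  have hVae : ∀ P : ℝ → Prop, (∀ᵐ s ∂lam, P s) → ∀ᵐ p ∂ϖ, P (V p) := by
    intro P hP
    rw [← hV] at hP
    exact ae_of_ae_map hVm.aemeasurable hP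
  have hp1 : ∀ᵐ p ∂ϖ, p.1 = q (V p) := by
    have e1 : ∀ᵐ x ∂(Measure.map q lam), x = hqmeas.mk q (τ x) := by
      refine (ae_map_iff hqmeas (measurableSet_eq_fun measurable_id
        (hqmeas.measurable_mk.comp hτm))).2 ?_
      filter_upwards [hτq', hqmeas.ae_eq_mk] with s h1 h2
      show q s = hqmeas.mk q (τ (q s))
      rw [h1, ← h2]
    rw [← hmarg] at e1
    have e2 := ae_of_ae_map measurable_fst.aemeasurable e1
    have e3 := hVae _ hqmeas.ae_eq_mk
    filter_upwards [e2, e3] with p h2 h3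
    rw [h3]
    exact h2
  have hVI := hVae _ hIco
  -- the second coordinate
  let B : Fin D → ℝ → Set ℝ := fun i s =>
    {c | c = 0 ∨ ∃ r x', 0 ≤ r ∧ r ≤ s ∧ (q r, x') ∈ S ∧ c = x' i}
  have hlater : ∀ s, 0 ≤ s → s < 1 → ∃ t x', s < t ∧ t < 1 ∧ (q t, x') ∈ S := by
    intro s h0 h1
    have hsub : Set.Ioo s 1 ∩ Set.Ico 0 1 = Set.Ioo s 1 :=
      Set.inter_eq_left.2 (fun x hx => ⟨h0.trans hx.1.le, hx.2⟩)
    have hpos : 0 < ϖ (V ⁻¹' Set.Ioo s 1) := by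
      rw [← Measure.map_apply hVm measurableSet_Ioo, hV, hlam,
        Measure.restrict_apply measurableSet_Ioo, hsub]
      simpa using h1
    by_contra! hcon
    refine hpos.ne' ?_
    have : ∀ᵐ p ∂ϖ, p ∉ V ⁻¹' Set.Ioo s 1 := by
      filter_upwards [hSae, hp1] with p h1 h2 h3
      refine hcon (V p) p.2 h3.1 h3.2 ?_
      rw [← h2]
      exact h1
    simpa using measure_eq_zero_iff_ae_notMem.2 this
  have hBbdd : ∀ i s, 0 ≤ s → s < 1 → BddAbove (B i s) := by
    intro i s h0 h1
    obtain ⟨t, y, hst, ht, hy⟩ := hlater s h0 h1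
    refine ⟨y i, ?_⟩
    rintro c (rfl | ⟨r, x', r0, hr, hx, rfl⟩)
    · exact hSnn _ hy i
    · exact hSmono _ hx _ hy (hqsi r t r0 (by linarith) ht) i
  let g : Fin D → ℝ → ℝ := fun i s => sSup (B i s)
  have hB0 : ∀ i s, (0 : ℝ) ∈ B i s := fun i s => Or.inl rfl
  have hg0 : ∀ i s, 0 ≤ s → s < 1 → 0 ≤ g i s := fun i s h0 h1 =>
    le_csSup (hBbdd i s h0 h1) (hB0 i s)
  have hgmono : ∀ i, MonotoneOn (g i) (Set.Ico 0 1) := by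
    intro i s hs t ht hst
    refine csSup_le_csSup (hBbdd i t ht.1 ht.2) ⟨0, hB0 i s⟩ ?_
    rintro c (h | ⟨r, x', r0, hr, hx, h⟩)
    · exact Or.inl h
    · exact Or.inr ⟨r, x', r0, hr.trans hst, hx, h⟩
  have hgcont : ∀ i, ∀ᵐ s ∂lam, ContinuousWithinAt (g i) (Set.Ico 0 1) s := by
    intro i
    have hc := (hgmono i).countable_not_continuousWithinAt
    have h1 : ∀ᵐ s ∂lam, s ∉ {x ∈ Set.Ico (0:ℝ) 1 | ¬ ContinuousWithinAt (g i) (Set.Ico 0 1) x} :=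
      measure_eq_zero_iff_ae_notMem.1 (hc.measure_zero _)
    filter_upwards [h1, hIco] with s a b
    by_contra h
    exact a ⟨b, h⟩
  have hne0 : ∀ᵐ s ∂lam, s ≠ 0 := by
    have : lam {0} = 0 := (Set.countable_singleton (0:ℝ)).measure_zero _
    filter_upwards [measure_eq_zero_iff_ae_notMem.1 this] with s hs
    exact hs
  have hp2 : ∀ᵐ p ∂ϖ, ∀ i, p.2 i = g i (V p) := by
    rw [ae_all_iff]
    intro i
    filter_upwards [hSae, hp1, hVI, hVae _ (hgcont i), hVae _ hne0] with p hpS hpq hI hcont h0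
    set s := V p
    have hsS : (q s, p.2) ∈ S := by rw [← hpq]; exact hpS
    have hs0 : 0 < s := lt_of_le_of_ne hI.1 (Ne.symm h0)
    apply le_antisymm
    · exact le_csSup (hBbdd i s hI.1 hI.2) (Or.inr ⟨s, p.2, hI.1, le_rfl, hsS, rfl⟩)
    · have hle : ∀ r ∈ Set.Ioo 0 s, g i r ≤ p.2 i := by
        intro r hr
        refine csSup_le ⟨0, hB0 i r⟩ ?_
        rintro c (rfl | ⟨r', x', r0, hr', hx, rfl⟩)
        · exact hSnn _ hpS i
        · exact hSmono _ hx _ hsS (hqsi r' s r0 (lt_of_le_of_lt hr' hr.2) hI.2) i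
      have hc2 : ContinuousWithinAt (g i) (Set.Ioo 0 s) s :=
        hcont.mono (fun r hr => ⟨hr.1.le, hr.2.trans hI.2⟩)
      have : (nhdsWithin s (Set.Ioo 0 s)).NeBot := right_nhdsWithin_Ioo_neBot hs0
      exact le_of_tendsto hc2 (Filter.eventually_of_mem self_mem_nhdsWithin hle)
  let qp : ℝ → EuclideanSpace ℝ (Fin D) × EuclideanSpace ℝ (Fin D) :=
    fun s => (q s, WithLp.toLp 2 (fun i => g i s))
  have hqp : AEMeasurable qp lam := by
    refine hqmeas.prodMk ?_
    have : AEMeasurable (fun s => fun i => g i s) lam :=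
      aemeasurable_pi_lambda _ fun i =>
        aemeasurable_restrict_of_monotoneOn measurableSet_Ico (hgmono i)
    exact (WithLp.measurable_toLp 2 _).comp_aemeasurable this
  refine ⟨qp, hqp, ?_, ?_, ?_⟩
  · intro s h0 h1
    exact ⟨hqcone s h0 h1, fun i => hg0 i s h0 h1⟩
  · intro s t h0 hst h1
    refine ⟨fun i => ?_, fun i => hgmono i ⟨h0, hst.trans_lt h1⟩ ⟨h0.trans hst, h1⟩ hst⟩
    rcases hst.eq_or_lt with h | h
    · rw [h]
    · exact (hqsi s t h0 h h1 i).le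
  · have hfin : ∀ᵐ p ∂ϖ, (qp ∘ V) p = id p := by
      filter_upwards [hp1, hp2] with p h1 h2
      refine Prod.ext h1.symm ?_
      ext i
      exact (h2 i).symm
    have hqp' : AEMeasurable qp (ϖ.map V) := by rw [hV]; exact hqp
    rw [← hV, AEMeasurable.map_map_of_aemeasurable hqp' hVm.aemeasurable,
      Measure.map_congr hfin, Measure.map_id]
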